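/- (Theorem 1, finite-alphabet form.) For every δ₁ > 0 and every γ ∈ ℝ there exists a decoder d whose error probability satisfies pe ≤ P[ ⋃_{(sdif,seq)} { ι^n(X_{sdif}; Y | X_{seq}, β_s) ≤ log C(p−k, ℓ) + log( (k²/δ₁²)·C(k,ℓ)² ) + γ } ] + P₀(γ) + 2δ₁, where the union is over all partitions of s = {1,…,k} into a nonempty set sdif and its complement seq in s, ℓ := |sdif|, C(·,·) denotes binomial coefficients, the probability is under the joint law conditioned on S = s, and P₀(γ) := P[ log( ∏_{i=1}^n P_{Y|X_sβ_s}(Y⁽ⁱ⁾ | X_s⁽ⁱ⁾, β_s) / P_{Y^n|X_s^n}(Y | X_s) ) > γ ] with P_{Y^n|X_s^n}(y | x) := Σ_{b ∈ ℬ^k} P_β(b) ∏_{i=1}^n P_{Y|X_sβ_s}(y⁽ⁱ⁾ | x⁽ⁱ⁾, b). -/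

import Mathlib

open Finset

attribute [local instance] Classical.propDecidable

namespace SupportRecoveryAch

variable {X B Y : Type*}

/-- `P_{Y|X_seq β_s}(y | x_seq, b)`: the conditional pmf of a single observation given only
the columns outside `sdif`, averaging the `sdif`-columns over the i.i.d. law `PX`. -/
noncomputable def margY [Fintype X] {k : ℕ} (PX : X → ℝ)
    (PY : Y → (Fin k → X) → (Fin k → B) → ℝ) (sdif : Finset (Fin k))
    (y : Y) (x : Fin k → X) (b : Fin k → B) : ℝ :=
  ∑ x' : {i // i ∈ sdif} → X,
    (∏ i, PX (x' i)) * PY y (fun i => if h : i ∈ sdif then x' ⟨i, h⟩ else x i) b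

/-- The `n`-measurement information density `ι^n(x_sdif; y | x_seq, b)`. -/
noncomputable def infoDens [Fintype X] {k n : ℕ} (PX : X → ℝ)
    (PY : Y → (Fin k → X) → (Fin k → B) → ℝ) (sdif : Finset (Fin k))
    (x : Fin n → Fin k → X) (y : Fin n → Y) (b : Fin k → B) : ℝ :=
  ∑ i, Real.log (PY (y i) (x i) b / margY PX PY sdif (y i) (x i) b)

/-- The joint pmf of `(S, X, β_S, Y)`:  `S` uniform on `k`-subsets of `{1,…,p}`, i.i.d.
measurement matrix, `β_S ~ P_β`, and conditionally i.i.d. observations, where row `i` of the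
matrix is restricted to the columns indexed by `S` (in increasing order). -/
noncomputable def joint (p k n : ℕ) (PX : X → ℝ) (Pβ : (Fin k → B) → ℝ)
    (PY : Y → (Fin k → X) → (Fin k → B) → ℝ)
    (ω : {s : Finset (Fin p) // s.card = k} ×
      (Fin n → Fin p → X) × (Fin k → B) × (Fin n → Y)) : ℝ :=
  ((p.choose k : ℝ))⁻¹ * (∏ i, ∏ j, PX (ω.2.1 i j)) * Pβ ω.2.2.1 *
    ∏ i, PY (ω.2.2.2 i) (fun t => ω.2.1 i (ω.1.1.orderEmbOfFin ω.1.2 t)) ω.2.2.1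

/-- The conditional pmf of `(X, β_s, Y)` given `S = s = {1,…,k}` (the first `k` columns). -/
noncomputable def cond {p k n : ℕ} (hkp : k ≤ p) (PX : X → ℝ) (Pβ : (Fin k → B) → ℝ)
    (PY : Y → (Fin k → X) → (Fin k → B) → ℝ)
    (ω : (Fin n → Fin p → X) × (Fin k → B) × (Fin n → Y)) : ℝ :=
  (∏ i, ∏ j, PX (ω.1 i j)) * Pβ ω.2.1 *
    ∏ i, PY (ω.2.2 i) (fun t => ω.1 i (Fin.castLE hkp t)) ω.2.1

/-- The i.i.d. weight of a matrix. -/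
noncomputable def matWeight {n q : ℕ} (PX : X → ℝ) (x : Fin n → Fin q → X) : ℝ :=
  ∏ i, ∏ j, PX (x i j)

/-- The likelihood of the observations given the relevant columns and `b`. -/
noncomputable def lik {n k : ℕ} (PY : Y → (Fin k → X) → (Fin k → B) → ℝ)
    (y : Fin n → Y) (x : Fin n → Fin k → X) (b : Fin k → B) : ℝ :=
  ∏ i, PY (y i) (x i) b

/-- The likelihood of the observations given `b` and the columns outside `D`. -/
noncomputable def margLik [Fintype X] {n k : ℕ} (PX : X → ℝ)
    (PY : Y → (Fin k → X) → (Fin k → B) → ℝ) (D : Finset (Fin k))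
    (y : Fin n → Y) (x : Fin n → Fin k → X) (b : Fin k → B) : ℝ :=
  ∏ i, margY PX PY D (y i) (x i) b

/-- Replace the columns of `x` indexed by `T` with those of `x'`. -/
noncomputable def mixCols {n q : ℕ} (T : Finset (Fin q)) (x x' : Fin n → Fin q → X) :
    Fin n → Fin q → X :=
  fun i j => if j ∈ T then x' i j else x i j

lemma sum_prod_comp_injective [Fintype X] {α β : Type*} [Fintype α] [Fintype β]
    (PX : X → ℝ) (hPX1 : ∑ x, PX x = 1) (f : α → β) (hf : Function.Injective f)
    (g : (α → X) → ℝ) :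
    ∑ x : β → X, (∏ j, PX (x j)) * g (x ∘ f) = ∑ z : α → X, (∏ a, PX (z a)) * g z := by
  have hsplit := Equiv.sum_comp
    (Equiv.piEquivPiSubtypeProd (fun j => j ∈ Set.range f) (fun _ => X)).symm
    (fun x : β → X => (∏ j, PX (x j)) * g (x ∘ f))
  rw [← hsplit, Fintype.sum_prod_type]
  have hone : ∑ v : {j // ¬ j ∈ Set.range f} → X, ∏ j, PX (v j) = 1 := by
    rw [← Fintype.prod_sum (fun (_ : {j // ¬ j ∈ Set.range f}) x => PX x)]
    simp [hPX1]
  have hre := Equiv.sum_comp ((Equiv.ofInjective f hf).arrowCongr (Equiv.refl X))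
    (fun u : {j // j ∈ Set.range f} → X =>
      (∏ j, PX (u j)) * g (fun a => u ⟨f a, a, rfl⟩))
  have hterm : ∀ (u : {j // j ∈ Set.range f} → X) (v : {j // ¬ j ∈ Set.range f} → X),
      (∏ j, PX ((Equiv.piEquivPiSubtypeProd (fun j => j ∈ Set.range f) (fun _ => X)).symm
        (u, v) j)) * g ((Equiv.piEquivPiSubtypeProd (fun j => j ∈ Set.range f)
          (fun _ => X)).symm (u, v) ∘ f)
      = ((∏ j, PX (u j)) * g (fun a => u ⟨f a, a, rfl⟩)) * ∏ j, PX (v j) := by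
    intro u v
    rw [← Fintype.prod_subtype_mul_prod_subtype (fun j => j ∈ Set.range f)]
    have h1 : ∀ j : {j // j ∈ Set.range f},
        (Equiv.piEquivPiSubtypeProd (fun j => j ∈ Set.range f) (fun _ => X)).symm (u, v) j
          = u j := fun j => by
      simp only [Equiv.piEquivPiSubtypeProd_symm_apply, dif_pos j.2]
    have h2 : ∀ j : {j // ¬ j ∈ Set.range f},
        (Equiv.piEquivPiSubtypeProd (fun j => j ∈ Set.range f) (fun _ => X)).symm (u, v) j
          = v j := fun j => by
      simp only [Equiv.piEquivPiSubtypeProd_symm_apply, dif_neg j.2]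
    have h3 : (Equiv.piEquivPiSubtypeProd (fun j => j ∈ Set.range f) (fun _ => X)).symm (u, v)
        ∘ f = fun a => u ⟨f a, a, rfl⟩ := funext fun a => h1 ⟨f a, a, rfl⟩
    simp only [h1, h2, h3]
    rw [mul_right_comm]
    congr!
  simp only [hterm]
  simp only [← Finset.mul_sum, hone, mul_one]
  rw [← hre]
  refine Finset.sum_congr rfl fun z _ => ?_
  congr 1
  · rw [← Equiv.prod_comp (Equiv.ofInjective f hf)]
    simp [Equiv.arrowCongr]
  · congr 1
    funext a
    simp [Equiv.arrowCongr]

lemma sum_matWeight_comp_injective [Fintype X] {n k q : ℕ} (PX : X → ℝ)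
    (hPX1 : ∑ x, PX x = 1) (f : Fin k → Fin q) (hf : Function.Injective f)
    (g : (Fin n → Fin k → X) → ℝ) :
    ∑ x : Fin n → Fin q → X, matWeight PX x * g (fun i t => x i (f t))
      = ∑ z : Fin n → Fin k → X, matWeight PX z * g z := by
  have h := sum_prod_comp_injective PX hPX1 (Prod.map (id : Fin n → Fin n) f)
    (Function.injective_id.prodMap hf) (fun z => g (Function.curry z))
  rw [← Equiv.sum_comp (Equiv.curry (Fin n) (Fin q) X),
    ← Equiv.sum_comp (Equiv.curry (Fin n) (Fin k) X)]
  simp only [Fintype.prod_prod_type] at h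
  convert! h

lemma sum_matWeight [Fintype X] {n q : ℕ} (PX : X → ℝ) (hPX1 : ∑ x, PX x = 1) :
    ∑ x : Fin n → Fin q → X, matWeight PX x = 1 := by
  unfold matWeight
  rw [← Fintype.prod_sum (fun (_ : Fin n) (r : Fin q → X) => ∏ j, PX (r j))]
  rw [← Fintype.prod_sum (fun (_ : Fin q) (x : X) => PX x)]
  simp [hPX1]

lemma matWeight_nonneg {n q : ℕ} {PX : X → ℝ} (hPX0 : ∀ x, 0 ≤ PX x)
    (x : Fin n → Fin q → X) : 0 ≤ matWeight PX x :=
  Finset.prod_nonneg fun _ _ => Finset.prod_nonneg fun _ _ => hPX0 _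

lemma margY_eq_sum [Fintype X] {k q : ℕ} (PX : X → ℝ) (hPX1 : ∑ x, PX x = 1)
    (PY : Y → (Fin k → X) → (Fin k → B) → ℝ) (e : Fin k → Fin q)
    (he : Function.Injective e) (T : Finset (Fin q)) (D : Finset (Fin k))
    (hD : ∀ t, t ∈ D ↔ e t ∈ T) (y : Y) (x : Fin q → X) (b : Fin k → B) :
    ∑ x' : Fin q → X, (∏ j, PX (x' j)) *
        PY y (fun t => if e t ∈ T then x' (e t) else x (e t)) b
      = margY PX PY D y (fun t => x (e t)) b := by
  have h := sum_prod_comp_injective PX hPX1 (fun t : {t // t ∈ D} => e t)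
    (he.comp Subtype.val_injective)
    (fun z => PY y (fun i => if h : i ∈ D then z ⟨i, h⟩ else x (e i)) b)
  have hm : margY PX PY D y (fun t => x (e t)) b = ∑ z : {t // t ∈ D} → X,
      (∏ a, PX (z a)) * PY y (fun i => if h : i ∈ D then z ⟨i, h⟩ else x (e i)) b := by
    unfold margY
    congr!
  rw [hm]
  refine Eq.trans ?_ (h.trans (by congr!))
  refine Finset.sum_congr (by congr!) fun x' _ => ?_
  congr 2
  funext t
  by_cases ht : t ∈ D
  · simp [ht, (hD t).1 ht]
  · have hT : e t ∉ T := fun h => ht ((hD t).2 h)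
    simp [ht, hT]

lemma margLik_eq_sum [Fintype X] {n k q : ℕ} (PX : X → ℝ) (hPX1 : ∑ x, PX x = 1)
    (PY : Y → (Fin k → X) → (Fin k → B) → ℝ) (e : Fin k → Fin q)
    (he : Function.Injective e) (T : Finset (Fin q)) (D : Finset (Fin k))
    (hD : ∀ t, t ∈ D ↔ e t ∈ T) (y : Fin n → Y) (x : Fin n → Fin q → X) (b : Fin k → B) :
    ∑ x' : Fin n → Fin q → X, matWeight PX x' * lik PY y (fun i t => mixCols T x x' i (e t)) b
      = margLik PX PY D y (fun i t => x i (e t)) b := by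
  unfold margLik
  simp only [← margY_eq_sum PX hPX1 PY e he T D hD]
  rw [Fintype.prod_sum]
  refine Finset.sum_congr rfl fun x' _ => ?_
  simp only [matWeight, lik, mixCols, Finset.prod_mul_distrib]

/-- Columns on which `F` does not depend may be replaced by an independent copy. -/
lemma sum_resample [Fintype X] {n q : ℕ} (PX : X → ℝ) (hPX1 : ∑ x, PX x = 1)
    (T : Finset (Fin q)) (F G : (Fin n → Fin q → X) → ℝ)
    (hF : ∀ x x', F (mixCols T x x') = F x) :
    ∑ x, matWeight PX x * (F x * G x)
      = ∑ x, matWeight PX x * (F x * ∑ x', matWeight PX x' * G (mixCols T x x')) := by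
  have hmix : ∀ x x' : Fin n → Fin q → X, mixCols T (mixCols T x x') (mixCols T x' x) = x := by
    intro x x'
    funext i j
    by_cases h : j ∈ T <;> simp [mixCols, h]
  let φ : ((Fin n → Fin q → X) × (Fin n → Fin q → X)) ≃
      ((Fin n → Fin q → X) × (Fin n → Fin q → X)) :=
    { toFun := fun z => (mixCols T z.1 z.2, mixCols T z.2 z.1)
      invFun := fun z => (mixCols T z.1 z.2, mixCols T z.2 z.1)
      left_inv := fun z => by simp [hmix]
      right_inv := fun z => by simp [hmix] }
  have hw : ∀ x x' : Fin n → Fin q → X,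
      matWeight PX (mixCols T x x') * matWeight PX (mixCols T x' x)
        = matWeight PX x * matWeight PX x' := by
    intro x x'
    simp only [matWeight, ← Finset.prod_mul_distrib]
    refine Finset.prod_congr rfl fun i _ => Finset.prod_congr rfl fun j _ => ?_
    by_cases h : j ∈ T <;> simp [mixCols, h, mul_comm]
  have hsum := Equiv.sum_comp φ
    (fun z => (matWeight PX z.1 * matWeight PX z.2) * (F z.1 * G z.1))
  simp only [φ, Equiv.coe_fn_mk, hw, hF] at hsum
  rw [Fintype.sum_prod_type, Fintype.sum_prod_type] at hsum
  calc ∑ x, matWeight PX x * (F x * G x)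
      = ∑ x, ∑ x', (matWeight PX x * matWeight PX x') * (F x * G x) := by
        refine Finset.sum_congr rfl fun x _ => ?_
        rw [← Finset.sum_mul, ← Finset.mul_sum, sum_matWeight PX hPX1, mul_one]
    _ = _ := by
        rw [← hsum]
        refine Finset.sum_congr rfl fun x _ => ?_
        rw [Finset.mul_sum, Finset.mul_sum]
        exact Finset.sum_congr rfl fun x' _ => by ring

lemma sum_lik_eq_sum_margLik [Fintype X] {n k q : ℕ} (PX : X → ℝ) (hPX1 : ∑ x, PX x = 1)
    (PY : Y → (Fin k → X) → (Fin k → B) → ℝ) (e : Fin k → Fin q)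
    (he : Function.Injective e) (T : Finset (Fin q)) (D : Finset (Fin k))
    (hD : ∀ t, t ∈ D ↔ e t ∈ T) (F : (Fin n → Fin q → X) → ℝ)
    (hF : ∀ x x', F (mixCols T x x') = F x) (y : Fin n → Y) (b : Fin k → B) :
    ∑ x, matWeight PX x * (F x * lik PY y (fun i t => x i (e t)) b)
      = ∑ x, matWeight PX x * (F x * margLik PX PY D y (fun i t => x i (e t)) b) := by
  rw [sum_resample PX hPX1 T F _ hF]
  simp only [margLik_eq_sum PX hPX1 PY e he T D hD]

lemma margY_congr [Fintype X] {k : ℕ} (PX : X → ℝ)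
    (PY : Y → (Fin k → X) → (Fin k → B) → ℝ) (D : Finset (Fin k)) (y : Y)
    {x x' : Fin k → X} (h : ∀ t, t ∉ D → x t = x' t) (b : Fin k → B) :
    margY PX PY D y x b = margY PX PY D y x' b := by
  unfold margY
  refine Finset.sum_congr rfl fun z _ => ?_
  congr 2
  funext t
  by_cases ht : t ∈ D
  · simp [ht]
  · simp [ht, h t ht]

lemma margY_perm [Fintype X] {k : ℕ} (PX : X → ℝ) (hPX1 : ∑ x, PX x = 1)
    (PY : Y → (Fin k → X) → (Fin k → B) → ℝ)
    (hPYperm : ∀ (σ : Equiv.Perm (Fin k)) (y : Y) (x : Fin k → X) (b : Fin k → B),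
      PY y (x ∘ σ) (b ∘ σ) = PY y x b)
    (σ : Equiv.Perm (Fin k)) (D D' : Finset (Fin k)) (hD : ∀ t, t ∈ D' ↔ σ t ∈ D)
    (y : Y) (x : Fin k → X) (b : Fin k → B) :
    margY PX PY D' y (x ∘ σ) (b ∘ σ) = margY PX PY D y x b := by
  have h := margY_eq_sum PX hPX1 PY id Function.injective_id D D (fun _ => Iff.rfl) y x b
  have h' := margY_eq_sum PX hPX1 PY σ σ.injective D D' hD y x (b ∘ σ)
  refine h'.symm.trans (Eq.trans ?_ h)
  refine Finset.sum_congr rfl fun x' _ => ?_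
  congr 1
  exact hPYperm σ y (fun t => if t ∈ D then x' t else x t) b

lemma exists_perm_of_injective {k q : ℕ} {e e' : Fin k → Fin q} (he : Function.Injective e)
    (he' : Function.Injective e') :
    ∃ σ : Equiv.Perm (Fin k), ∀ t, e' t ∈ Set.range e → e (σ t) = e' t := by
  obtain ⟨g, hg⟩ := Set.MapsTo.exists_equiv_extend_of_card_eq
    (t := Finset.univ.map ⟨e, he⟩) (by simp) (s := {t | e' t ∈ Set.range e}) (f := e')
    (fun t ht => by simpa using ht) (he'.injOn)
  have hmem : ∀ t, ∃ u, e u = g t := fun t => by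
    obtain ⟨u, -, hu⟩ := Finset.mem_map.1 (g t).2
    exact ⟨u, hu⟩
  choose f hf using hmem
  have hinj : Function.Injective f := fun a b hab =>
    g.injective (Subtype.ext (by rw [← hf a, ← hf b, hab]))
  exact ⟨Equiv.ofBijective f (Finite.injective_iff_bijective.1 hinj),
    fun t ht => (hf t).trans (hg t ht)⟩

/-- The likelihood averaged over `b`. -/
noncomputable def avgLik [Fintype B] {n k : ℕ} (Pβ : (Fin k → B) → ℝ)
    (PY : Y → (Fin k → X) → (Fin k → B) → ℝ) (y : Fin n → Y) (x : Fin n → Fin k → X) : ℝ :=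
  ∑ b, Pβ b * lik PY y x b

/-- The marginal likelihood averaged over `b`. -/
noncomputable def avgMargLik [Fintype X] [Fintype B] {n k : ℕ} (PX : X → ℝ)
    (Pβ : (Fin k → B) → ℝ) (PY : Y → (Fin k → X) → (Fin k → B) → ℝ) (D : Finset (Fin k))
    (y : Fin n → Y) (x : Fin n → Fin k → X) : ℝ :=
  ∑ b, Pβ b * margLik PX PY D y x b

lemma margLik_congr [Fintype X] {n k : ℕ} (PX : X → ℝ)
    (PY : Y → (Fin k → X) → (Fin k → B) → ℝ) (D : Finset (Fin k)) (y : Fin n → Y)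
    {x x' : Fin n → Fin k → X} (h : ∀ i t, t ∉ D → x i t = x' i t) (b : Fin k → B) :
    margLik PX PY D y x b = margLik PX PY D y x' b :=
  Finset.prod_congr rfl fun i _ => margY_congr PX PY D (y i) (h i) b

lemma avgMargLik_congr [Fintype X] [Fintype B] {n k : ℕ} (PX : X → ℝ)
    (Pβ : (Fin k → B) → ℝ) (PY : Y → (Fin k → X) → (Fin k → B) → ℝ) (D : Finset (Fin k))
    (y : Fin n → Y) {x x' : Fin n → Fin k → X} (h : ∀ i t, t ∉ D → x i t = x' i t) :
    avgMargLik PX Pβ PY D y x = avgMargLik PX Pβ PY D y x' :=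
  Finset.sum_congr rfl fun b _ => by rw [margLik_congr PX PY D y h b]

/-- The averaged marginal likelihood depends only on the shared columns of two supports. -/
lemma avgMargLik_eq_of_embeddings [Fintype X] [Fintype B] {n k q : ℕ} (PX : X → ℝ)
    (hPX1 : ∑ x, PX x = 1) (Pβ : (Fin k → B) → ℝ)
    (hPβperm : ∀ (σ : Equiv.Perm (Fin k)) (b : Fin k → B), Pβ (b ∘ σ) = Pβ b)
    (PY : Y → (Fin k → X) → (Fin k → B) → ℝ)
    (hPYperm : ∀ (σ : Equiv.Perm (Fin k)) (y : Y) (x : Fin k → X) (b : Fin k → B),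
      PY y (x ∘ σ) (b ∘ σ) = PY y x b)
    {e e' : Fin k → Fin q} (he : Function.Injective e) (he' : Function.Injective e')
    (D D' : Finset (Fin k)) (hD : ∀ t, t ∈ D ↔ e t ∉ Set.range e')
    (hD' : ∀ t, t ∈ D' ↔ e' t ∉ Set.range e) (y : Fin n → Y) (x : Fin n → Fin q → X) :
    avgMargLik PX Pβ PY D y (fun i t => x i (e t))
      = avgMargLik PX Pβ PY D' y (fun i t => x i (e' t)) := by
  obtain ⟨σ, hσ⟩ := exists_perm_of_injective he he'
  have hDD : ∀ t, t ∈ D' ↔ σ t ∈ D := by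
    intro t
    rw [hD, hD', not_iff_not]
    constructor
    · exact fun h => ⟨t, (hσ t h).symm⟩
    · rintro ⟨u, hu⟩
      have h1 := hσ u ⟨_, hu.symm⟩
      have h2 : u = t := σ.injective (he (h1.trans hu))
      exact ⟨σ t, by rw [← hu, h2]⟩
  have hcongr : avgMargLik PX Pβ PY D' y (fun i t => x i (e' t))
      = avgMargLik PX Pβ PY D' y (fun i t => x i (e (σ t))) :=
    avgMargLik_congr PX Pβ PY D' y fun i t ht => by
      rw [hσ t (not_not.1 fun h => ht ((hD' t).2 h))]
  rw [hcongr]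
  unfold avgMargLik
  rw [← Equiv.sum_comp (σ.symm.arrowCongr (Equiv.refl B))
    (fun b => Pβ b * margLik PX PY D' y (fun i t => x i (e (σ t))) b)]
  refine Finset.sum_congr rfl fun b _ => ?_
  have hb : (σ.symm.arrowCongr (Equiv.refl B)) b = b ∘ σ := rfl
  rw [hb, hPβperm]
  congr 1
  exact Finset.prod_congr rfl fun i _ =>
    (margY_perm PX hPX1 PY hPYperm σ D D' hDD (y i) (fun t => x i (e t)) b).symm

lemma lik_pos {n k : ℕ} {PY : Y → (Fin k → X) → (Fin k → B) → ℝ}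
    (hPY0 : ∀ y x b, 0 < PY y x b) (y : Fin n → Y) (x : Fin n → Fin k → X) (b : Fin k → B) :
    0 < lik PY y x b :=
  Finset.prod_pos fun _ _ => hPY0 _ _ _

lemma sum_mul_pos {ι : Type*} [Fintype ι] {f g : ι → ℝ} (hf0 : ∀ i, 0 ≤ f i)
    (hf1 : ∑ i, f i = 1) (hg : ∀ i, 0 < g i) : 0 < ∑ i, f i * g i := by
  obtain ⟨i, -, hi⟩ : ∃ i ∈ Finset.univ, f i ≠ 0 :=
    Finset.exists_ne_zero_of_sum_ne_zero (by rw [hf1]; exact one_ne_zero)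
  exact Finset.sum_pos' (fun j _ => mul_nonneg (hf0 j) (hg j).le)
    ⟨i, Finset.mem_univ i, mul_pos (lt_of_le_of_ne (hf0 i) hi.symm) (hg i)⟩

lemma margY_pos [Fintype X] {k : ℕ} {PX : X → ℝ} (hPX0 : ∀ x, 0 ≤ PX x)
    (hPX1 : ∑ x, PX x = 1) {PY : Y → (Fin k → X) → (Fin k → B) → ℝ}
    (hPY0 : ∀ y x b, 0 < PY y x b) (D : Finset (Fin k)) (y : Y) (x : Fin k → X)
    (b : Fin k → B) : 0 < margY PX PY D y x b := by
  refine sum_mul_pos (fun _ => Finset.prod_nonneg fun _ _ => hPX0 _) ?_ fun _ => hPY0 _ _ _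
  rw [← Fintype.prod_sum (fun (_ : {i // i ∈ D}) x => PX x)]
  simp [hPX1]

lemma sum_margY [Fintype X] [Fintype Y] {k : ℕ} {PX : X → ℝ}
    (hPX1 : ∑ x, PX x = 1) {PY : Y → (Fin k → X) → (Fin k → B) → ℝ}
    (hPY1 : ∀ x b, ∑ y, PY y x b = 1) (D : Finset (Fin k)) (x : Fin k → X)
    (b : Fin k → B) : ∑ y, margY PX PY D y x b = 1 := by
  unfold margY
  rw [Finset.sum_comm]
  simp only [← Finset.mul_sum, hPY1, mul_one]
  rw [← Fintype.prod_sum (fun (_ : {i // i ∈ D}) x => PX x)]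
  simp [hPX1]

lemma margLik_pos [Fintype X] {n k : ℕ} {PX : X → ℝ} (hPX0 : ∀ x, 0 ≤ PX x)
    (hPX1 : ∑ x, PX x = 1) {PY : Y → (Fin k → X) → (Fin k → B) → ℝ}
    (hPY0 : ∀ y x b, 0 < PY y x b) (D : Finset (Fin k)) (y : Fin n → Y)
    (x : Fin n → Fin k → X) (b : Fin k → B) : 0 < margLik PX PY D y x b :=
  Finset.prod_pos fun _ _ => margY_pos hPX0 hPX1 hPY0 _ _ _ _

lemma sum_avgLik [Fintype B] [Fintype Y] {n k : ℕ} {Pβ : (Fin k → B) → ℝ}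
    (hPβ1 : ∑ b, Pβ b = 1) {PY : Y → (Fin k → X) → (Fin k → B) → ℝ}
    (hPY1 : ∀ x b, ∑ y, PY y x b = 1) (x : Fin n → Fin k → X) :
    ∑ y, avgLik Pβ PY y x = 1 := by
  have h : ∀ b, ∑ y, lik PY y x b = 1 := fun b => by
    unfold lik
    rw [← Fintype.prod_sum (fun i y => PY y (x i) b)]
    simp [hPY1]
  unfold avgLik
  rw [Finset.sum_comm]
  simp only [← Finset.mul_sum, h, mul_one, hPβ1]

lemma sum_avgMargLik [Fintype X] [Fintype B] [Fintype Y] {n k : ℕ} {PX : X → ℝ}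
    (hPX1 : ∑ x, PX x = 1) {Pβ : (Fin k → B) → ℝ}
    (hPβ1 : ∑ b, Pβ b = 1) {PY : Y → (Fin k → X) → (Fin k → B) → ℝ}
    (hPY1 : ∀ x b, ∑ y, PY y x b = 1) (D : Finset (Fin k)) (x : Fin n → Fin k → X) :
    ∑ y, avgMargLik PX Pβ PY D y x = 1 := by
  have h : ∀ b, ∑ y, margLik PX PY D y x b = 1 := fun b => by
    unfold margLik
    rw [← Fintype.prod_sum (fun i y => margY PX PY D y (x i) b)]
    simp [sum_margY hPX1 hPY1]
  unfold avgMargLik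
  rw [Finset.sum_comm]
  simp only [← Finset.mul_sum, h, mul_one, hPβ1]

/-- The probability of an event when the columns picked by `e` are the relevant ones. -/
noncomputable def prob [Fintype X] [Fintype B] [Fintype Y] {n k q : ℕ} (PX : X → ℝ)
    (Pβ : (Fin k → B) → ℝ) (PY : Y → (Fin k → X) → (Fin k → B) → ℝ) (e : Fin k → Fin q)
    (E : (Fin n → Fin q → X) → (Fin k → B) → (Fin n → Y) → Prop) : ℝ :=
  ∑ x, ∑ b, ∑ y, if E x b y then matWeight PX x * Pβ b * lik PY y (fun i t => x i (e t)) b else 0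

lemma prob_comp_injective [Fintype X] [Fintype B] [Fintype Y] {n k q : ℕ} {PX : X → ℝ}
    (hPX1 : ∑ x, PX x = 1) (Pβ : (Fin k → B) → ℝ)
    (PY : Y → (Fin k → X) → (Fin k → B) → ℝ) {e : Fin k → Fin q}
    (he : Function.Injective e) (E : (Fin n → Fin k → X) → (Fin k → B) → (Fin n → Y) → Prop) :
    prob PX Pβ PY e (fun x b y => E (fun i t => x i (e t)) b y) = prob PX Pβ PY id E := by
  have h := sum_matWeight_comp_injective (n := n) PX hPX1 e he
    (fun z => ∑ b, ∑ y, if E z b y then Pβ b * lik PY y z b else 0)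
  simpa only [Finset.mul_sum, mul_ite, mul_zero, ← mul_assoc] using! h

lemma prob_le_add [Fintype X] [Fintype B] [Fintype Y] {n k q : ℕ} {PX : X → ℝ}
    (hPX0 : ∀ x, 0 ≤ PX x) {Pβ : (Fin k → B) → ℝ} (hPβ0 : ∀ b, 0 ≤ Pβ b)
    {PY : Y → (Fin k → X) → (Fin k → B) → ℝ} (hPY0 : ∀ y x b, 0 < PY y x b)
    (e : Fin k → Fin q) {E E₁ E₂ : (Fin n → Fin q → X) → (Fin k → B) → (Fin n → Y) → Prop}
    (h : ∀ x b y, E x b y → E₁ x b y ∨ E₂ x b y) :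
    prob PX Pβ PY e E ≤ prob PX Pβ PY e E₁ + prob PX Pβ PY e E₂ := by
  unfold prob
  simp only [← Finset.sum_add_distrib]
  refine Finset.sum_le_sum fun x _ => Finset.sum_le_sum fun b _ => Finset.sum_le_sum fun y _ => ?_
  have h0 : 0 ≤ matWeight PX x * Pβ b * lik PY y (fun i t => x i (e t)) b :=
    mul_nonneg (mul_nonneg (matWeight_nonneg hPX0 x) (hPβ0 b)) (lik_pos hPY0 _ _ _).le
  have hE := h x b y
  split_ifs <;> first | linarith | (exfalso; tauto)

lemma prob_exists_le_sum [Fintype X] [Fintype B] [Fintype Y] {n k q : ℕ} {PX : X → ℝ}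
    (hPX0 : ∀ x, 0 ≤ PX x) {Pβ : (Fin k → B) → ℝ} (hPβ0 : ∀ b, 0 ≤ Pβ b)
    {PY : Y → (Fin k → X) → (Fin k → B) → ℝ} (hPY0 : ∀ y x b, 0 < PY y x b)
    (e : Fin k → Fin q) {ι : Type*} (A : Finset ι)
    (E : ι → (Fin n → Fin q → X) → (Fin k → B) → (Fin n → Y) → Prop) :
    prob PX Pβ PY e (fun x b y => ∃ i ∈ A, E i x b y) ≤ ∑ i ∈ A, prob PX Pβ PY e (E i) := by
  induction A using Finset.induction_on with
  | empty => simp [prob]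
  | insert i A hi ih =>
    rw [Finset.sum_insert hi]
    refine (prob_le_add hPX0 hPβ0 hPY0 e (E₁ := E i)
      (E₂ := fun x b y => ∃ i ∈ A, E i x b y) ?_).trans (by linarith)
    rintro x b y ⟨j, hj, hE⟩
    rcases Finset.mem_insert.1 hj with rfl | hj
    · exact Or.inl hE
    · exact Or.inr ⟨j, hj, hE⟩

/-- If an event does not depend on the columns in `T`, then they may be averaged out. -/
lemma prob_eq_sum_margLik [Fintype X] [Fintype B] [Fintype Y] {n k q : ℕ} {PX : X → ℝ}
    (hPX1 : ∑ x, PX x = 1) (Pβ : (Fin k → B) → ℝ)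
    (PY : Y → (Fin k → X) → (Fin k → B) → ℝ) {e : Fin k → Fin q}
    (he : Function.Injective e) (T : Finset (Fin q)) (D : Finset (Fin k))
    (hD : ∀ t, t ∈ D ↔ e t ∈ T)
    (E : (Fin n → Fin q → X) → (Fin k → B) → (Fin n → Y) → Prop)
    (hE : ∀ x x' b y, E (mixCols T x x') b y ↔ E x b y) :
    prob PX Pβ PY e E = ∑ x, matWeight PX x * ∑ y, ∑ b,
      if E x b y then Pβ b * margLik PX PY D y (fun i t => x i (e t)) b else 0 := by
  have h : ∀ b y, ∑ x, matWeight PX x * ((if E x b y then Pβ b else 0) *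
        lik PY y (fun i t => x i (e t)) b)
      = ∑ x, matWeight PX x * ((if E x b y then Pβ b else 0) *
        margLik PX PY D y (fun i t => x i (e t)) b) := fun b y =>
    sum_lik_eq_sum_margLik PX hPX1 PY e he T D hD (fun x => if E x b y then Pβ b else 0)
      (fun x x' => by simp only [hE]) y b
  have hswap : ∀ f : (Fin n → Fin q → X) → (Fin k → B) → (Fin n → Y) → ℝ,
      ∑ x, ∑ b, ∑ y, f x b y = ∑ b, ∑ y, ∑ x, f x b y := fun f => by
    rw [Finset.sum_comm]
    exact Finset.sum_congr rfl fun b _ => Finset.sum_comm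
  calc prob PX Pβ PY e E
      = ∑ x, ∑ b, ∑ y, matWeight PX x * ((if E x b y then Pβ b else 0) *
          lik PY y (fun i t => x i (e t)) b) := by
        simp only [prob, ite_mul, zero_mul, mul_ite, mul_zero, ← mul_assoc]
    _ = ∑ x, ∑ b, ∑ y, matWeight PX x * ((if E x b y then Pβ b else 0) *
          margLik PX PY D y (fun i t => x i (e t)) b) := by
        rw [hswap, hswap]
        exact Finset.sum_congr rfl fun b _ => Finset.sum_congr rfl fun y _ => h b y
    _ = _ := by
        refine Finset.sum_congr rfl fun x _ => ?_
        rw [Finset.sum_comm]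
        simp only [Finset.mul_sum, ite_mul, zero_mul]

/-- The probability that a wrong support passes one likelihood-ratio test. -/
lemma prob_avgLik_gt_le [Fintype X] [Fintype B] [Fintype Y] {n k q : ℕ} {PX : X → ℝ}
    (hPX0 : ∀ x, 0 ≤ PX x) (hPX1 : ∑ x, PX x = 1) {Pβ : (Fin k → B) → ℝ}
    (hPβ0 : ∀ b, 0 ≤ Pβ b) (hPβ1 : ∑ b, Pβ b = 1)
    (hPβperm : ∀ (σ : Equiv.Perm (Fin k)) (b : Fin k → B), Pβ (b ∘ σ) = Pβ b)
    {PY : Y → (Fin k → X) → (Fin k → B) → ℝ}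
    (hPY0 : ∀ y x b, 0 < PY y x b) (hPY1 : ∀ x b, ∑ y, PY y x b = 1)
    (hPYperm : ∀ (σ : Equiv.Perm (Fin k)) (y : Y) (x : Fin k → X) (b : Fin k → B),
      PY y (x ∘ σ) (b ∘ σ) = PY y x b)
    {e e' : Fin k → Fin q} (he : Function.Injective e) (he' : Function.Injective e')
    (D' : Finset (Fin k)) (hD' : ∀ t, t ∈ D' ↔ e' t ∉ Set.range e) {τ : ℝ} (hτ : 0 < τ) :
    prob (n := n) PX Pβ PY e (fun x _ y => τ * avgMargLik PX Pβ PY D' y (fun i t => x i (e' t))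
        < avgLik Pβ PY y (fun i t => x i (e' t))) ≤ τ⁻¹ := by
  set D : Finset (Fin k) := Finset.univ.filter fun t => e t ∉ Set.range e' with hDdef
  have hD : ∀ t, t ∈ D ↔ e t ∉ Set.range e' := fun t => by simp [hDdef]
  set T : Finset (Fin q) := Finset.univ.filter fun j => j ∉ Set.range e' with hTdef
  have hmix : ∀ x x' : Fin n → Fin q → X,
      (fun i t => mixCols T x x' i (e' t)) = fun i t => x i (e' t) := fun x x' => by
    funext i t
    simp [mixCols, hTdef]
  rw [prob_eq_sum_margLik hPX1 Pβ PY he T D (fun t => by simp [hDdef, hTdef]) _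
    (fun x x' b y => by rw [hmix])]
  have hx : ∀ x : Fin n → Fin q → X, (∑ y, ∑ b,
      if τ * avgMargLik PX Pβ PY D' y (fun i t => x i (e' t))
        < avgLik Pβ PY y (fun i t => x i (e' t))
      then Pβ b * margLik PX PY D y (fun i t => x i (e t)) b else 0) ≤ τ⁻¹ := by
    intro x
    calc _ ≤ ∑ y, τ⁻¹ * avgLik Pβ PY y (fun i t => x i (e' t)) := by
          refine Finset.sum_le_sum fun y _ => ?_
          split_ifs with h
          · change avgMargLik PX Pβ PY D y (fun i t => x i (e t)) ≤ _
            rw [avgMargLik_eq_of_embeddings PX hPX1 Pβ hPβperm PY hPYperm he he' D D' hD hD']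
            rw [inv_mul_eq_div, le_div_iff₀ hτ, mul_comm]
            exact h.le
          · rw [Finset.sum_const_zero]
            exact mul_nonneg (inv_nonneg.2 hτ.le) (Finset.sum_nonneg fun b _ =>
              mul_nonneg (hPβ0 b) (lik_pos hPY0 _ _ _).le)
      _ = τ⁻¹ := by rw [← Finset.mul_sum, sum_avgLik hPβ1 hPY1, mul_one]
  calc _ ≤ ∑ x : Fin n → Fin q → X, matWeight PX x * τ⁻¹ :=
        Finset.sum_le_sum fun x _ => mul_le_mul_of_nonneg_left (hx x) (matWeight_nonneg hPX0 x)
    _ = τ⁻¹ := by rw [← Finset.sum_mul, sum_matWeight PX hPX1, one_mul]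

/-- The probability that the marginal likelihood is much smaller than its average over `b`. -/
lemma prob_margLik_lt_le [Fintype X] [Fintype B] [Fintype Y] {n k : ℕ} {PX : X → ℝ}
    (hPX0 : ∀ x, 0 ≤ PX x) (hPX1 : ∑ x, PX x = 1) {Pβ : (Fin k → B) → ℝ}
    (hPβ0 : ∀ b, 0 ≤ Pβ b) (hPβ1 : ∑ b, Pβ b = 1)
    {PY : Y → (Fin k → X) → (Fin k → B) → ℝ}
    (hPY0 : ∀ y x b, 0 < PY y x b) (hPY1 : ∀ x b, ∑ y, PY y x b = 1)
    (D : Finset (Fin k)) {ε : ℝ} (hε : 0 ≤ ε) :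
    prob (n := n) PX Pβ PY id (fun x b y => margLik PX PY D y x b
        < ε * avgMargLik PX Pβ PY D y x) ≤ ε := by
  have hmix : ∀ (x x' : Fin n → Fin k → X) i t, t ∉ D → mixCols D x x' i t = x i t :=
    fun x x' i t ht => by simp [mixCols, ht]
  rw [prob_eq_sum_margLik hPX1 Pβ PY Function.injective_id D D (fun t => Iff.rfl) _
    (fun x x' b y => by
      rw [margLik_congr PX PY D y (hmix x x'), avgMargLik_congr PX Pβ PY D y (hmix x x')])]
  have hx : ∀ x : Fin n → Fin k → X, (∑ y, ∑ b,
      if margLik PX PY D y x b < ε * avgMargLik PX Pβ PY D y x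
      then Pβ b * margLik PX PY D y x b else 0) ≤ ε := by
    intro x
    calc _ ≤ ∑ y, ∑ b, Pβ b * (ε * avgMargLik PX Pβ PY D y x) := by
          refine Finset.sum_le_sum fun y _ => Finset.sum_le_sum fun b _ => ?_
          split_ifs with h
          · exact mul_le_mul_of_nonneg_left h.le (hPβ0 b)
          · exact mul_nonneg (hPβ0 b) (mul_nonneg hε (Finset.sum_nonneg fun b _ =>
              mul_nonneg (hPβ0 b) (margLik_pos hPX0 hPX1 hPY0 _ _ _ _).le))
      _ = ε := by
          simp only [← Finset.sum_mul, hPβ1, one_mul, ← Finset.mul_sum,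
            sum_avgMargLik hPX1 hPβ1 hPY1, mul_one]
  calc _ ≤ ∑ x : Fin n → Fin k → X, matWeight PX x * ε :=
        Finset.sum_le_sum fun x _ => mul_le_mul_of_nonneg_left (hx x) (matWeight_nonneg hPX0 x)
    _ = ε := by rw [← Finset.sum_mul, sum_matWeight PX hPX1, one_mul]

/-- Weighting each class of size at most `N ℓ` by `δ / (k N ℓ)` gives total mass at most `δ`. -/
lemma sum_inv_class_size_le {ι : Type*} (A : Finset ι) (c : ι → ℕ) (N : ℕ → ℕ) {k : ℕ}
    (hk : 1 ≤ k) (hc : ∀ i ∈ A, c i ∈ Finset.Icc 1 k)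
    (hN : ∀ l ∈ Finset.Icc 1 k, (A.filter fun i => c i = l).card ≤ N l)
    {δ : ℝ} (hδ : 0 < δ) :
    ∑ i ∈ A, ((k : ℝ) / δ * N (c i))⁻¹ ≤ δ := by
  have hk0 : (0 : ℝ) < k := by exact_mod_cast hk
  rw [← Finset.sum_fiberwise_of_maps_to hc]
  calc _ ≤ ∑ l ∈ Finset.Icc 1 k, δ / k := by
        refine Finset.sum_le_sum fun l hl => ?_
        have h1 : ∑ i ∈ A with c i = l, ((k : ℝ) / δ * N (c i))⁻¹
            = (A.filter fun i => c i = l).card * ((k : ℝ) / δ * N l)⁻¹ := by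
          rw [← nsmul_eq_mul, ← Finset.sum_const]
          exact Finset.sum_congr rfl fun i hi => by rw [(Finset.mem_filter.1 hi).2]
        rw [h1]
        have h2 : ((A.filter fun i => c i = l).card : ℝ) ≤ N l := by exact_mod_cast hN l hl
        calc _ ≤ (N l : ℝ) * ((k : ℝ) / δ * N l)⁻¹ :=
              mul_le_mul_of_nonneg_right h2 (by positivity)
          _ ≤ δ / k := by
              rcases Nat.eq_zero_or_pos (N l) with h0 | h0
              · simp only [h0, Nat.cast_zero, zero_mul]; positivity
              · have : (0 : ℝ) < N l := by exact_mod_cast h0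
                apply le_of_eq
                field_simp
    _ = δ := by
        simp only [Finset.sum_const, Nat.card_Icc, Nat.add_sub_cancel, nsmul_eq_mul]
        field_simp

lemma card_filter_sdiff_card_le {p k : ℕ} (s : {s : Finset (Fin p) // s.card = k}) (l : ℕ) :
    ((Finset.univ : Finset {s : Finset (Fin p) // s.card = k}).filter
        fun u => (u.1 \ s.1).card = l).card ≤ (p - k).choose l * k.choose l := by
  have hcard : ((s.1ᶜ.powersetCard l) ×ˢ (s.1.powersetCard l)).card
      = (p - k).choose l * k.choose l := by
    simp [Finset.card_compl, s.2]
  rw [← hcard]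
  refine Finset.card_le_card_of_injOn (fun u => (u.1 \ s.1, s.1 \ u.1)) ?_ ?_
  · intro u hu
    have hu' : (u.1 \ s.1).card = l := by simpa using hu
    have hsu : (s.1 \ u.1).card = l := by
      rw [← hu']
      exact Finset.card_sdiff_comm (s.2.trans u.2.symm)
    simp only [Finset.coe_product, Set.mem_prod, Finset.mem_coe, Finset.mem_powersetCard]
    refine ⟨⟨fun j hj => ?_, hu'⟩, Finset.sdiff_subset, hsu⟩
    exact Finset.mem_compl.2 (Finset.mem_sdiff.1 hj).2
  · intro u _ v _ huv
    simp only [Prod.mk.injEq] at huv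
    refine Subtype.ext (Finset.ext fun j => ?_)
    have h1 := Finset.ext_iff.1 huv.1 j
    have h2 := Finset.ext_iff.1 huv.2 j
    simp only [Finset.mem_sdiff] at h1 h2
    tauto

/-- The threshold `(k / δ) C(p - k, ℓ) C(k, ℓ)` of the likelihood-ratio tests. -/
noncomputable def threshold (p k : ℕ) (δ : ℝ) (l : ℕ) : ℝ :=
  (k : ℝ) / δ * (((p - k).choose l * k.choose l : ℕ) : ℝ)

/-- The columns `x` explain the observations `y` by passing every likelihood-ratio test. -/
def Passes [Fintype X] [Fintype B] {n k : ℕ} (p : ℕ) (δ : ℝ) (PX : X → ℝ)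
    (Pβ : (Fin k → B) → ℝ) (PY : Y → (Fin k → X) → (Fin k → B) → ℝ)
    (x : Fin n → Fin k → X) (y : Fin n → Y) : Prop :=
  ∀ D : Finset (Fin k), D.Nonempty →
    threshold p k δ D.card * avgMargLik PX Pβ PY D y x < avgLik Pβ PY y x

lemma infoDens_eq_log [Fintype X] {n k : ℕ} {PX : X → ℝ} (hPX0 : ∀ x, 0 ≤ PX x)
    (hPX1 : ∑ x, PX x = 1) {PY : Y → (Fin k → X) → (Fin k → B) → ℝ}
    (hPY0 : ∀ y x b, 0 < PY y x b) (D : Finset (Fin k)) (y : Fin n → Y)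
    (x : Fin n → Fin k → X) (b : Fin k → B) :
    infoDens PX PY D x y b = Real.log (lik PY y x b / margLik PX PY D y x b) := by
  unfold infoDens lik margLik
  rw [← Finset.prod_div_distrib, Real.log_prod]
  exact fun i _ => (div_pos (hPY0 _ _ _) (margY_pos hPX0 hPX1 hPY0 _ _ _ _)).ne'

/-- A failed test forces a small information density, unless the likelihood given `b` is
much larger, or the marginal likelihood given `b` much smaller, than its average. -/
lemma infoDens_le_of_avgLik_le [Fintype X] [Fintype B] {n k p : ℕ} (hk : 1 ≤ k)
    {PX : X → ℝ} (hPX0 : ∀ x, 0 ≤ PX x) (hPX1 : ∑ x, PX x = 1) {Pβ : (Fin k → B) → ℝ}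
    (hPβ0 : ∀ b, 0 ≤ Pβ b) (hPβ1 : ∑ b, Pβ b = 1)
    {PY : Y → (Fin k → X) → (Fin k → B) → ℝ} (hPY0 : ∀ y x b, 0 < PY y x b)
    {δ γ : ℝ} (hδ : 0 < δ) (D : Finset (Fin k)) (y : Fin n → Y)
    (x : Fin n → Fin k → X) (b : Fin k → B)
    (hfail : avgLik Pβ PY y x ≤ threshold p k δ D.card * avgMargLik PX Pβ PY D y x)
    (hlik : Real.log (lik PY y x b / avgLik Pβ PY y x) ≤ γ)
    (hmarg : ((k : ℝ) / δ * (k.choose D.card : ℕ))⁻¹ * avgMargLik PX Pβ PY D y x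
      ≤ margLik PX PY D y x b) :
    infoDens PX PY D x y b ≤ Real.log (((p - k).choose D.card : ℝ))
      + Real.log (((k : ℝ) ^ 2 / δ ^ 2) * ((k.choose D.card : ℝ)) ^ 2) + γ := by
  have hk0 : (0 : ℝ) < k := by exact_mod_cast hk
  have hL : 0 < avgLik Pβ PY y x := sum_mul_pos hPβ0 hPβ1 fun b => lik_pos hPY0 y x b
  have hQ : 0 < avgMargLik PX Pβ PY D y x :=
    sum_mul_pos hPβ0 hPβ1 fun b => margLik_pos hPX0 hPX1 hPY0 D y x b
  have hP := lik_pos hPY0 y x b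
  have hM := margLik_pos hPX0 hPX1 hPY0 D y x b
  have hDk : D.card ≤ k := by simpa using Finset.card_le_univ D
  have hC : (0 : ℝ) < k.choose D.card := by exact_mod_cast Nat.choose_pos hDk
  have hA : (0 : ℝ) < (p - k).choose D.card := by
    rcases Nat.eq_zero_or_pos ((p - k).choose D.card) with h0 | h0
    · simp only [threshold, h0, zero_mul, Nat.cast_zero, mul_zero] at hfail
      linarith
    · exact_mod_cast h0
  rw [infoDens_eq_log hPX0 hPX1 hPY0]
  have hP' : lik PY y x b ≤ Real.exp γ * avgLik Pβ PY y x := by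
    rw [Real.log_le_iff_le_exp (div_pos hP hL), div_le_iff₀ hL] at hlik
    exact hlik
  have hQ' : avgMargLik PX Pβ PY D y x ≤ (k : ℝ) / δ * (k.choose D.card) *
      margLik PX PY D y x b := by
    rwa [inv_mul_le_iff₀ (by positivity)] at hmarg
  have hkey : lik PY y x b / margLik PX PY D y x b ≤ ((p - k).choose D.card : ℝ) *
      (((k : ℝ) ^ 2 / δ ^ 2) * ((k.choose D.card : ℝ)) ^ 2) * Real.exp γ := by
    rw [div_le_iff₀ hM]
    calc lik PY y x b ≤ Real.exp γ * avgLik Pβ PY y x := hP'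
      _ ≤ Real.exp γ * (threshold p k δ D.card * avgMargLik PX Pβ PY D y x) := by gcongr
      _ ≤ Real.exp γ * (threshold p k δ D.card *
          ((k : ℝ) / δ * (k.choose D.card) * margLik PX PY D y x b)) := by
        have : 0 ≤ threshold p k δ D.card := by unfold threshold; positivity
        gcongr
      _ = _ := by
        unfold threshold
        push_cast
        field_simp
  calc _ ≤ Real.log (((p - k).choose D.card : ℝ) *
      (((k : ℝ) ^ 2 / δ ^ 2) * ((k.choose D.card : ℝ)) ^ 2) * Real.exp γ) :=
        Real.log_le_log (div_pos hP hM) hkey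
    _ = _ := by
      rw [Real.log_mul (by positivity) (by positivity), Real.log_mul (by positivity)
        (by positivity), Real.log_exp]

/-- The probability that the true support fails some likelihood-ratio test. -/
lemma prob_not_passes_le [Fintype X] [Fintype B] [Fintype Y] {n k p : ℕ} (hk : 1 ≤ k)
    {PX : X → ℝ} (hPX0 : ∀ x, 0 ≤ PX x) (hPX1 : ∑ x, PX x = 1) {Pβ : (Fin k → B) → ℝ}
    (hPβ0 : ∀ b, 0 ≤ Pβ b) (hPβ1 : ∑ b, Pβ b = 1)
    {PY : Y → (Fin k → X) → (Fin k → B) → ℝ}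
    (hPY0 : ∀ y x b, 0 < PY y x b) (hPY1 : ∀ x b, ∑ y, PY y x b = 1)
    {δ : ℝ} (hδ : 0 < δ) (γ : ℝ) :
    prob (n := n) PX Pβ PY id (fun x _ y => ¬ Passes p δ PX Pβ PY x y) ≤
      prob (n := n) PX Pβ PY id (fun x b y => ∃ D : Finset (Fin k), D.Nonempty ∧
          infoDens PX PY D x y b ≤ Real.log (((p - k).choose D.card : ℝ))
            + Real.log (((k : ℝ) ^ 2 / δ ^ 2) * ((k.choose D.card : ℝ)) ^ 2) + γ)
      + prob (n := n) PX Pβ PY id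
          (fun x b y => γ < Real.log (lik PY y x b / avgLik Pβ PY y x)) + δ := by
  set A : Finset (Finset (Fin k)) := Finset.univ.filter fun D => D.Nonempty with hA
  set ε : Finset (Fin k) → ℝ := fun D => ((k : ℝ) / δ * (k.choose D.card : ℕ))⁻¹ with hεdef
  have hsum : ∑ D ∈ A, ε D ≤ δ := by
    refine sum_inv_class_size_le A Finset.card (fun l => k.choose l) hk ?_ ?_ hδ
    · intro D hD
      have hD' : D.Nonempty := by simpa [hA] using hD
      exact Finset.mem_Icc.2 ⟨hD'.card_pos, by simpa using Finset.card_le_univ D⟩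
    · intro l _
      calc _ ≤ ((Finset.univ : Finset (Fin k)).powersetCard l).card :=
            Finset.card_le_card fun D hD => by
              simpa [Finset.mem_powersetCard] using (Finset.mem_filter.1 hD).2
        _ = k.choose l := by simp
  have hbad : prob (n := n) PX Pβ PY id (fun x b y => ∃ D ∈ A,
      margLik PX PY D y x b < ε D * avgMargLik PX Pβ PY D y x) ≤ δ :=
    (prob_exists_le_sum hPX0 hPβ0 hPY0 id A _).trans <|
      (Finset.sum_le_sum fun D _ => prob_margLik_lt_le hPX0 hPX1 hPβ0 hPβ1 hPY0 hPY1 D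
        (by simp only [hεdef]; positivity)).trans hsum
  set E₁ : (Fin n → Fin k → X) → (Fin k → B) → (Fin n → Y) → Prop :=
    fun x b y => ∃ D : Finset (Fin k), D.Nonempty ∧
          infoDens PX PY D x y b ≤ Real.log (((p - k).choose D.card : ℝ))
            + Real.log (((k : ℝ) ^ 2 / δ ^ 2) * ((k.choose D.card : ℝ)) ^ 2) + γ
  set E₂ : (Fin n → Fin k → X) → (Fin k → B) → (Fin n → Y) → Prop :=
    fun x b y => γ < Real.log (lik PY y x b / avgLik Pβ PY y x)
  set E₃ : (Fin n → Fin k → X) → (Fin k → B) → (Fin n → Y) → Prop := fun x b y => ∃ D ∈ A,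
      margLik PX PY D y x b < ε D * avgMargLik PX Pβ PY D y x
  have h12 : prob PX Pβ PY id (fun x b y => E₁ x b y ∨ E₂ x b y)
      ≤ prob PX Pβ PY id E₁ + prob PX Pβ PY id E₂ :=
    prob_le_add hPX0 hPβ0 hPY0 id fun _ _ _ h => h
  have h123 : prob (n := n) PX Pβ PY id (fun x _ y => ¬ Passes p δ PX Pβ PY x y)
      ≤ prob PX Pβ PY id (fun x b y => E₁ x b y ∨ E₂ x b y) + prob PX Pβ PY id E₃ := by
    refine prob_le_add hPX0 hPβ0 hPY0 id fun x b y h => ?_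
    unfold Passes at h
    push Not at h
    obtain ⟨D, hD, hfail⟩ := h
    by_cases h2 : E₂ x b y
    · exact Or.inl (Or.inr h2)
    by_cases h3 : E₃ x b y
    · exact Or.inr h3
    refine Or.inl (Or.inl ⟨D, hD, infoDens_le_of_avgLik_le hk hPX0 hPX1 hPβ0 hPβ1 hPY0 hδ D y x b
      hfail (not_lt.1 h2) (not_lt.1 fun h => h3 ⟨D, by simpa [hA] using hD, h⟩)⟩)
  linarith

/-- The probability that some wrong support passes every likelihood-ratio test. -/
lemma prob_exists_passes_le [Fintype X] [Fintype B] [Fintype Y] {n k p : ℕ} (hk : 1 ≤ k)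
    {PX : X → ℝ} (hPX0 : ∀ x, 0 ≤ PX x) (hPX1 : ∑ x, PX x = 1) {Pβ : (Fin k → B) → ℝ}
    (hPβ0 : ∀ b, 0 ≤ Pβ b) (hPβ1 : ∑ b, Pβ b = 1)
    (hPβperm : ∀ (σ : Equiv.Perm (Fin k)) (b : Fin k → B), Pβ (b ∘ σ) = Pβ b)
    {PY : Y → (Fin k → X) → (Fin k → B) → ℝ}
    (hPY0 : ∀ y x b, 0 < PY y x b) (hPY1 : ∀ x b, ∑ y, PY y x b = 1)
    (hPYperm : ∀ (σ : Equiv.Perm (Fin k)) (y : Y) (x : Fin k → X) (b : Fin k → B),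
      PY y (x ∘ σ) (b ∘ σ) = PY y x b)
    {δ : ℝ} (hδ : 0 < δ) (s : {s : Finset (Fin p) // s.card = k}) :
    prob (n := n) PX Pβ PY (s.1.orderEmbOfFin s.2) (fun x _ y =>
      ∃ u ∈ (Finset.univ : Finset {s : Finset (Fin p) // s.card = k}).filter (· ≠ s),
        Passes p δ PX Pβ PY (fun i t => x i (u.1.orderEmbOfFin u.2 t)) y) ≤ δ := by
  have hk0 : (0 : ℝ) < k := by exact_mod_cast hk
  have hc : ∀ u ∈ (Finset.univ : Finset {s : Finset (Fin p) // s.card = k}).filter (· ≠ s),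
      (u.1 \ s.1).card ∈ Finset.Icc 1 k := by
    intro u hu
    have hne : u ≠ s := by simpa using hu
    refine Finset.mem_Icc.2 ⟨?_, (Finset.card_le_card Finset.sdiff_subset).trans u.2.le⟩
    rw [Nat.one_le_iff_ne_zero, Ne, Finset.card_eq_zero, Finset.sdiff_eq_empty_iff_subset]
    exact fun h => hne (Subtype.ext (Finset.eq_of_subset_of_card_le h (by rw [s.2, u.2])))
  refine (prob_exists_le_sum hPX0 hPβ0 hPY0 _ _ _).trans ((Finset.sum_le_sum ?_).trans
    (sum_inv_class_size_le _ (fun u : {s : Finset (Fin p) // s.card = k} => (u.1 \ s.1).card)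
      (fun l => (p - k).choose l * k.choose l) hk hc ?_ hδ))
  · intro u hu
    set D' : Finset (Fin k) :=
      Finset.univ.filter fun t => u.1.orderEmbOfFin u.2 t ∉ s.1 with hD'
    have hmap : D'.map (u.1.orderEmbOfFin u.2).toEmbedding = u.1 \ s.1 := by
      ext j
      simp only [hD', Finset.mem_map, Finset.mem_filter, Finset.mem_univ, true_and,
        Finset.mem_sdiff, RelEmbedding.coe_toEmbedding]
      constructor
      · rintro ⟨t, ht, rfl⟩
        exact ⟨Finset.orderEmbOfFin_mem _ _ _, ht⟩
      · rintro ⟨hj, hjs⟩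
        have : j ∈ Set.range (u.1.orderEmbOfFin u.2) := by
          rw [Finset.range_orderEmbOfFin]; exact hj
        obtain ⟨t, rfl⟩ := this
        exact ⟨t, hjs, rfl⟩
    have hcard : D'.card = (u.1 \ s.1).card := by rw [← hmap, Finset.card_map]
    have hIcc := Finset.mem_Icc.1 (hc u hu)
    have hle : (u.1 \ s.1).card ≤ p - k := by
      have hsub : u.1 \ s.1 ⊆ s.1ᶜ := fun j hj => Finset.mem_compl.2 (Finset.mem_sdiff.1 hj).2
      have := Finset.card_le_card hsub
      rwa [Finset.card_compl, s.2, Fintype.card_fin] at this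
    have hpos : 0 < threshold p k δ D'.card := by
      have h : 0 < (p - k).choose D'.card * k.choose D'.card := by
        rw [hcard]
        exact Nat.mul_pos (Nat.choose_pos hle) (Nat.choose_pos hIcc.2)
      have h' : (0 : ℝ) < (((p - k).choose D'.card * k.choose D'.card : ℕ) : ℝ) := by
        exact_mod_cast h
      exact mul_pos (div_pos hk0 hδ) h'
    have hpair := prob_avgLik_gt_le (n := n) hPX0 hPX1 hPβ0 hPβ1 hPβperm hPY0 hPY1 hPYperm
      (s.1.orderEmbOfFin s.2).injective (u.1.orderEmbOfFin u.2).injective D'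
      (fun t => by simp [hD']) hpos
    have hne : D'.Nonempty := Finset.card_pos.1 (by omega)
    rw [← hcard]
    refine le_trans ?_ hpair
    have hzero : prob (n := n) PX Pβ PY (s.1.orderEmbOfFin s.2) (fun _ _ _ => False) = 0 := by
      simp [prob]
    have := prob_le_add (n := n) hPX0 hPβ0 hPY0 (s.1.orderEmbOfFin s.2)
      (E := fun x _ y => Passes p δ PX Pβ PY (fun i t => x i (u.1.orderEmbOfFin u.2 t)) y)
      (E₁ := fun x _ y => threshold p k δ D'.card *
        avgMargLik PX Pβ PY D' y (fun i t => x i (u.1.orderEmbOfFin u.2 t))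
          < avgLik Pβ PY y (fun i t => x i (u.1.orderEmbOfFin u.2 t)))
      (E₂ := fun _ _ _ => False) (fun x b y h => Or.inl (h D' hne))
    rwa [hzero, add_zero] at this
  · intro l _
    refine (Finset.card_le_card fun u hu => ?_).trans (card_filter_sdiff_card_le s l)
    simpa using (Finset.mem_filter.1 hu).2

/-- Theorem 1 (achievability), finite-alphabet form. -/
theorem achievability (p k n : ℕ) (hk : 1 ≤ k) (hkp : k ≤ p) (hn : 1 ≤ n)
    [Fintype X] [Fintype B] [Fintype Y] [Nonempty X] [Nonempty B] [Nonempty Y]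
    (PX : X → ℝ) (hPX0 : ∀ x, 0 ≤ PX x) (hPX1 : ∑ x, PX x = 1)
    (Pβ : (Fin k → B) → ℝ) (hPβ0 : ∀ b, 0 ≤ Pβ b) (hPβ1 : ∑ b, Pβ b = 1)
    (hPβperm : ∀ (σ : Equiv.Perm (Fin k)) (b : Fin k → B), Pβ (b ∘ σ) = Pβ b)
    (PY : Y → (Fin k → X) → (Fin k → B) → ℝ)
    (hPY0 : ∀ y x b, 0 < PY y x b) (hPY1 : ∀ x b, ∑ y, PY y x b = 1)
    (hPYperm : ∀ (σ : Equiv.Perm (Fin k)) (y : Y) (x : Fin k → X) (b : Fin k → B),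
      PY y (x ∘ σ) (b ∘ σ) = PY y x b)
    (δ₁ : ℝ) (hδ₁ : 0 < δ₁) (γ : ℝ) :
    ∃ d : (Fin n → Fin p → X) → (Fin n → Y) → {s : Finset (Fin p) // s.card = k},
      -- pe  =  P[d(X, Y) ≠ S]
      (∑ ω : {s : Finset (Fin p) // s.card = k} ×
          (Fin n → Fin p → X) × (Fin k → B) × (Fin n → Y),
        if d ω.2.1 ω.2.2.2 ≠ ω.1 then joint p k n PX Pβ PY ω else 0)
      ≤
      -- P[ ⋃_{(sdif,seq)} { ι^n ≤ log C(p−k, ℓ) + log((k²/δ₁²) C(k,ℓ)²) + γ } | S = s ]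
      (∑ ω : (Fin n → Fin p → X) × (Fin k → B) × (Fin n → Y),
        if (∃ sdif : Finset (Fin k), sdif.Nonempty ∧
            infoDens PX PY sdif (fun i t => ω.1 i (Fin.castLE hkp t)) ω.2.2 ω.2.1
              ≤ Real.log (((p - k).choose sdif.card : ℝ))
                + Real.log (((k : ℝ) ^ 2 / δ₁ ^ 2) * ((k.choose sdif.card : ℝ)) ^ 2) + γ)
          then cond hkp PX Pβ PY ω else 0)
      -- + P₀(γ)
      + (∑ ω : (Fin n → Fin p → X) × (Fin k → B) × (Fin n → Y),
          if γ < Real.log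
              ((∏ i, PY (ω.2.2 i) (fun t => ω.1 i (Fin.castLE hkp t)) ω.2.1) /
                (∑ b, Pβ b * ∏ i, PY (ω.2.2 i) (fun t => ω.1 i (Fin.castLE hkp t)) b))
          then cond hkp PX Pβ PY ω else 0)
      + 2 * δ₁ := by
  have hcard : Fintype.card {s : Finset (Fin p) // s.card = k} = p.choose k := by
    simp
  have hne : Nonempty {s : Finset (Fin p) // s.card = k} := by
    rw [← Fintype.card_pos_iff, hcard]
    exact Nat.choose_pos hkp
  let d : (Fin n → Fin p → X) → (Fin n → Y) → {s : Finset (Fin p) // s.card = k} :=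
    fun x y => Classical.epsilon fun s : {s : Finset (Fin p) // s.card = k} =>
      Passes p δ₁ PX Pβ PY (fun i t => x i (s.1.orderEmbOfFin s.2 t)) y
  refine ⟨d, ?_⟩
  have hcastinj : Function.Injective (Fin.castLE hkp) := Fin.castLE_injective hkp
  have hR₁ := prob_comp_injective (n := n) hPX1 Pβ PY hcastinj
    (fun x b y => ∃ D : Finset (Fin k), D.Nonempty ∧
      infoDens PX PY D x y b ≤ Real.log (((p - k).choose D.card : ℝ))
        + Real.log (((k : ℝ) ^ 2 / δ₁ ^ 2) * ((k.choose D.card : ℝ)) ^ 2) + γ)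
  have hR₂ := prob_comp_injective (n := n) hPX1 Pβ PY hcastinj
    (fun x b y => γ < Real.log (lik PY y x b / avgLik Pβ PY y x))
  have hmiss := prob_not_passes_le (n := n) (p := p) hk hPX0 hPX1 hPβ0 hPβ1 hPY0 hPY1 hδ₁ γ
  rw [← hR₁, ← hR₂] at hmiss
  have herr : ∀ s : {s : Finset (Fin p) // s.card = k},
      prob PX Pβ PY (s.1.orderEmbOfFin s.2) (fun x _ y => d x y ≠ s) ≤
        prob (n := n) PX Pβ PY id (fun x _ y => ¬ Passes p δ₁ PX Pβ PY x y) + δ₁ := by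
    intro s
    rw [← prob_comp_injective hPX1 Pβ PY (s.1.orderEmbOfFin s.2).injective]
    refine (prob_le_add hPX0 hPβ0 hPY0 _ (E₂ := fun x _ y =>
      ∃ u ∈ (Finset.univ : Finset {s : Finset (Fin p) // s.card = k}).filter (· ≠ s),
        Passes p δ₁ PX Pβ PY (fun i t => x i (u.1.orderEmbOfFin u.2 t)) y) ?_).trans
      (add_le_add_right (prob_exists_passes_le hk hPX0 hPX1 hPβ0 hPβ1 hPβperm hPY0 hPY1 hPYperm
        hδ₁ s) _)
    intro x b y hd
    by_cases hs : Passes p δ₁ PX Pβ PY (fun i t => x i (s.1.orderEmbOfFin s.2 t)) y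
    · exact Or.inr ⟨d x y, by simpa using hd,
        Classical.epsilon_spec (p := fun s : {s : Finset (Fin p) // s.card = k} =>
          Passes p δ₁ PX Pβ PY (fun i t => x i (s.1.orderEmbOfFin s.2 t)) y) ⟨s, hs⟩⟩
    · exact Or.inl hs
  have hC : (0 : ℝ) < p.choose k := by exact_mod_cast Nat.choose_pos hkp
  have hpe : (∑ ω : {s : Finset (Fin p) // s.card = k} ×
          (Fin n → Fin p → X) × (Fin k → B) × (Fin n → Y),
        if d ω.2.1 ω.2.2.2 ≠ ω.1 then joint p k n PX Pβ PY ω else 0)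
      = ∑ s : {s : Finset (Fin p) // s.card = k}, (p.choose k : ℝ)⁻¹ *
          prob PX Pβ PY (s.1.orderEmbOfFin s.2) (fun x _ y => d x y ≠ s) := by
    simp only [Fintype.sum_prod_type, prob, Finset.mul_sum, mul_ite, mul_zero, joint, matWeight,
      lik, ← mul_assoc]
  have hR₁' : prob (n := n) PX Pβ PY (Fin.castLE hkp) (fun x b y => ∃ D : Finset (Fin k),
      D.Nonempty ∧ infoDens PX PY D (fun i t => x i (Fin.castLE hkp t)) y b
        ≤ Real.log (((p - k).choose D.card : ℝ))
        + Real.log (((k : ℝ) ^ 2 / δ₁ ^ 2) * ((k.choose D.card : ℝ)) ^ 2) + γ) =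
      (∑ ω : (Fin n → Fin p → X) × (Fin k → B) × (Fin n → Y),
        if (∃ sdif : Finset (Fin k), sdif.Nonempty ∧
            infoDens PX PY sdif (fun i t => ω.1 i (Fin.castLE hkp t)) ω.2.2 ω.2.1
              ≤ Real.log (((p - k).choose sdif.card : ℝ))
                + Real.log (((k : ℝ) ^ 2 / δ₁ ^ 2) * ((k.choose sdif.card : ℝ)) ^ 2) + γ)
          then cond hkp PX Pβ PY ω else 0) := by
    simp only [Fintype.sum_prod_type, prob, cond, matWeight, lik]
    congr!
  have hR₂' : prob (n := n) PX Pβ PY (Fin.castLE hkp) (fun x b y =>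
      γ < Real.log (lik PY y (fun i t => x i (Fin.castLE hkp t)) b /
        avgLik Pβ PY y (fun i t => x i (Fin.castLE hkp t)))) =
      (∑ ω : (Fin n → Fin p → X) × (Fin k → B) × (Fin n → Y),
          if γ < Real.log
              ((∏ i, PY (ω.2.2 i) (fun t => ω.1 i (Fin.castLE hkp t)) ω.2.1) /
                (∑ b, Pβ b * ∏ i, PY (ω.2.2 i) (fun t => ω.1 i (Fin.castLE hkp t)) b))
          then cond hkp PX Pβ PY ω else 0) := by
    simp only [Fintype.sum_prod_type, prob, cond, matWeight, lik, avgLik]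
  rw [hpe, ← hR₁', ← hR₂']
  calc _ ≤ ∑ _s : {s : Finset (Fin p) // s.card = k}, (p.choose k : ℝ)⁻¹ *
          (prob (n := n) PX Pβ PY id (fun x _ y => ¬ Passes p δ₁ PX Pβ PY x y) + δ₁) :=
        Finset.sum_le_sum fun s _ => mul_le_mul_of_nonneg_left (herr s) (inv_nonneg.2 hC.le)
    _ = prob (n := n) PX Pβ PY id (fun x _ y => ¬ Passes p δ₁ PX Pβ PY x y) + δ₁ := by
        rw [Finset.sum_const, Finset.card_univ, hcard, nsmul_eq_mul, ← mul_assoc,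
          mul_inv_cancel₀ hC.ne', one_mul]
    _ ≤ _ := by linarith

end SupportRecoveryAch
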